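/- arXiv:1205.4875 — 5 statements merged into one kernel-verified Lean document; each statement's English description precedes it below -/
import Mathlib

section
/- For each n ≥ 3 there exists a number k_n such that no k ≥ k_n has an optimal embedding in ℤ^n. -/
open Set

/-- The Lee (Manhattan) distance between two words in `ℤ^n`. -/
def leeDist {n : ℕ} (v w : Fin n → ℤ) : ℕ := ∑ i, (v i - w i).natAbs

/-- The Lee sphere `S_{n,r}` of radius `r` centered at the origin. -/
def leeSphere (n r : ℕ) : Set (Fin n → ℤ) := {x | leeDist x 0 ≤ r}

/-- `|S_{n,r}|`, the cardinality of the Lee sphere. -/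
noncomputable def sphereCard (n r : ℕ) : ℕ := (leeSphere n r).ncard

/-- `k` has an optimal embedding in `ℤ^n`: for the unique `r` with
`|S_{n,r}| ≤ k < |S_{n,r+1}|`, there is a finite abelian group `G` of order `k`
and a homomorphism `φ : ℤ^n → G` injective on `S_{n,r}` and surjective on `S_{n,r+1}`. -/
def HasOptimalEmbedding (n k : ℕ) : Prop :=
  ∃ r : ℕ, sphereCard n r ≤ k ∧ k < sphereCard n (r + 1) ∧
    ∃ (G : Type) (_ : AddCommGroup G) (_ : Fintype G) (φ : (Fin n → ℤ) →+ G),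
      Nat.card G = k ∧
      Set.InjOn φ (leeSphere n r) ∧ Set.SurjOn φ (leeSphere n (r + 1)) Set.univ

theorem leeDist_triangle_coord {n : ℕ} (u v w : Fin n → ℤ) (i : Fin n) :
    (u i - v i).natAbs + (v i - w i).natAbs + leeDist u w ≤
      (u i - w i).natAbs + leeDist u v + leeDist v w := by
  unfold leeDist
  rw [← Finset.add_sum_erase _ _ (Finset.mem_univ i),
    ← Finset.add_sum_erase _ (fun j => (u j - v j).natAbs) (Finset.mem_univ i),
    ← Finset.add_sum_erase _ (fun j => (v j - w j).natAbs) (Finset.mem_univ i)]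
  have h : ∑ j ∈ Finset.univ.erase i, (u j - w j).natAbs ≤
      ∑ j ∈ Finset.univ.erase i, (u j - v j).natAbs +
        ∑ j ∈ Finset.univ.erase i, (v j - w j).natAbs := by
    rw [← Finset.sum_add_distrib]
    exact Finset.sum_le_sum fun j _ => by omega
  omega

theorem leeDist_triangle {n : ℕ} (u v w : Fin n → ℤ) :
    leeDist u w ≤ leeDist u v + leeDist v w := by
  unfold leeDist
  rw [← Finset.sum_add_distrib]
  exact Finset.sum_le_sum fun j _ => by omega

theorem leeDist_comm {n : ℕ} (u v : Fin n → ℤ) : leeDist u v = leeDist v u :=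
  Finset.sum_congr rfl fun j _ => by omega

theorem leeDist_self {n : ℕ} (u : Fin n → ℤ) : leeDist u u = 0 := by
  simp [leeDist]

theorem leeDist_sub_zero {n : ℕ} (u v : Fin n → ℤ) : leeDist (u - v) 0 = leeDist u v := by
  simp [leeDist]

theorem natAbs_le_leeDist {n : ℕ} (u v : Fin n → ℤ) (i : Fin n) :
    (u i - v i).natAbs ≤ leeDist u v :=
  Finset.single_le_sum (f := fun j => (u j - v j).natAbs) (fun _ _ => Nat.zero_le _)
    (Finset.mem_univ i)

theorem leeDist_update {n : ℕ} (u w : Fin n → ℤ) (i : Fin n) (c : ℤ) :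
    leeDist (Function.update u i c) w + (u i - w i).natAbs =
      leeDist u w + (c - w i).natAbs := by
  unfold leeDist
  rw [← Finset.add_sum_erase _ _ (Finset.mem_univ i),
    ← Finset.add_sum_erase _ (fun j => (u j - w j).natAbs) (Finset.mem_univ i)]
  have h : ∑ j ∈ Finset.univ.erase i, (Function.update u i c j - w j).natAbs =
      ∑ j ∈ Finset.univ.erase i, (u j - w j).natAbs :=
    Finset.sum_congr rfl fun j hj => by
      rw [Function.update_of_ne (Finset.ne_of_mem_erase hj)]
  rw [h, Function.update_self]
  omega

/-- A lattice path from `0` to `v` passes through a point splitting the distance as prescribed. -/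
theorem exists_leeDist_split {n : ℕ} (v : Fin n → ℤ) (m : ℕ) (hm : m ≤ leeDist v 0) :
    ∃ x, leeDist x 0 ≤ m ∧ leeDist x v + m ≤ leeDist v 0 := by
  induction m with
  | zero => exact ⟨0, (leeDist_self 0).le, (leeDist_comm 0 v).le⟩
  | succ m ih =>
    obtain ⟨x, hx, hxv⟩ := ih (by omega)
    by_cases h : x = v
    · subst h
      omega
    · obtain ⟨i, hi⟩ := Function.ne_iff.mp h
      obtain ⟨c, hc, hc'⟩ : ∃ c : ℤ, c.natAbs ≤ (x i).natAbs + 1 ∧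
          (c - v i).natAbs + 1 = (x i - v i).natAbs := by
        rcases lt_or_gt_of_ne hi with hi | hi
        · exact ⟨x i + 1, by omega, by omega⟩
        · exact ⟨x i - 1, by omega, by omega⟩
      have h0 := leeDist_update x 0 i c
      have hv := leeDist_update x v i c
      simp only [Pi.zero_apply, sub_zero] at h0
      exact ⟨Function.update x i c, by omega, by omega⟩

/-- Injectivity on the sphere of radius `r` forces the kernel to have minimum distance `> 2r`. -/
theorem two_mul_lt_leeDist_of_injOn {n r : ℕ} {G : Type} [AddCommGroup G]
    {φ : (Fin n → ℤ) →+ G} (hφ : Set.InjOn φ (leeSphere n r)) {u v : Fin n → ℤ}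
    (hu : φ u = 0) (hv : φ v = 0) (huv : u ≠ v) : 2 * r < leeDist u v := by
  by_contra! hle
  rw [← leeDist_sub_zero] at hle
  obtain ⟨x, hx, hxv⟩ := exists_leeDist_split (u - v) (min r (leeDist (u - v) 0))
    (min_le_right _ _)
  have hmem : x - (u - v) ∈ leeSphere n r := by
    change leeDist (x - (u - v)) 0 ≤ r
    rw [leeDist_sub_zero]
    omega
  have hxr : x ∈ leeSphere n r := hx.trans (min_le_left _ _)
  have h := hφ hxr hmem (by simp [hu, hv])
  exact huv (sub_eq_zero.mp (sub_eq_self.mp h.symm))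

theorem exists_ker_leeDist_le_of_surjOn {n R : ℕ} {G : Type} [AddCommGroup G]
    {φ : (Fin n → ℤ) →+ G} (hφ : Set.SurjOn φ (leeSphere n R) Set.univ) (x : Fin n → ℤ) :
    ∃ v, φ v = 0 ∧ leeDist x v ≤ R := by
  obtain ⟨y, hy, hxy⟩ := hφ (Set.mem_univ (φ x))
  refine ⟨x - y, by simp [hxy], ?_⟩
  have h : leeDist x (x - y) = leeDist y 0 := by simp [leeDist]
  rw [h]
  exact hy

/-- A lattice with minimum distance at least `2r + 1` and covering radius at most `r + 1` has,
for every height `3 ≤ a ≤ r + 2`, a vector of bounded norm whose `i`-th coordinate is close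
to `a`: look at what covers the points around the ridge of the sphere at height `a`. -/
theorem exists_coord_near {n r : ℕ} {S : Set (Fin n → ℤ)} (h0 : 0 ∈ S)
    (hpack : ∀ u ∈ S, ∀ v ∈ S, u ≠ v → 2 * r < leeDist u v)
    (hcover : ∀ x, ∃ v ∈ S, leeDist x v ≤ r + 1)
    {i j l : Fin n} (hij : i ≠ j) (hil : i ≠ l) (hjl : j ≠ l)
    {a : ℕ} (ha : 3 ≤ a) (har : a ≤ r + 2) :
    ∃ v ∈ S, leeDist v 0 ≤ 2 * r + 6 ∧ (v i - a).natAbs ≤ 2 := by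
  obtain ⟨p, hpi, hpl, hp⟩ : ∃ p : Fin n → ℤ, p i = a ∧ p l = 0 ∧ leeDist p 0 = r + 2 := by
    refine ⟨Function.update (Function.update 0 i (a : ℤ)) j ((r + 2 - a : ℕ) : ℤ), ?_, ?_, ?_⟩
    · simp [hij]
    · simp [hil.symm, hjl.symm]
    · have h1 := leeDist_update (Function.update 0 i (a : ℤ)) 0 j ((r + 2 - a : ℕ) : ℤ)
      have h2 := leeDist_update 0 0 i (a : ℤ)
      rw [leeDist_self] at h2
      rw [Function.update_of_ne hij.symm] at h1
      simp only [Pi.zero_apply, sub_zero, Int.natAbs_natCast, Int.natAbs_zero] at h1 h2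
      omega
  obtain ⟨u, hu, hpu⟩ := hcover p
  have hu0 : u ≠ 0 := by
    rintro rfl
    omega
  obtain ⟨c, hc, hcu⟩ : ∃ c : ℤ, c.natAbs = 3 ∧ (c - u l).natAbs = (u l).natAbs + 3 := by
    rcases le_total (u l) 0 with h | h
    · exact ⟨3, by omega, by omega⟩
    · exact ⟨-3, by omega, by omega⟩
  obtain ⟨q, hqi, hq, hqu⟩ : ∃ q : Fin n → ℤ, q i = a ∧ leeDist q 0 = r + 5 ∧
      leeDist q u = leeDist p u + 3 := by
    have h1 := leeDist_update p 0 l c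
    have h2 := leeDist_update p u l c
    rw [hpl] at h1 h2
    simp only [Pi.zero_apply, sub_zero] at h1
    exact ⟨Function.update p l c, by simp [hil, hpi], by omega, by omega⟩
  obtain ⟨v, hv, hqv⟩ := hcover q
  have hv0 : v ≠ 0 := by
    rintro rfl
    omega
  have hu2 := hpack u hu 0 h0 hu0
  have hv2 := hpack v hv 0 h0 hv0
  have hup := leeDist_triangle u p 0
  have hvq := leeDist_triangle v q 0
  rw [leeDist_comm u p] at hup
  rw [leeDist_comm v q] at hvq
  have huv : u ≠ v := by
    rintro rfl
    omega
  have huv2 := hpack u hu v hv huv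
  have e1 := leeDist_triangle_coord u p 0 i
  have e2 := leeDist_triangle_coord v q 0 i
  have e3 := leeDist_triangle_coord u q v i
  rw [leeDist_comm u p, hpi] at e1
  rw [leeDist_comm v q, hqi] at e2
  rw [leeDist_comm u q, hqi] at e3
  simp only [Pi.zero_apply, sub_zero] at e1 e2
  by_cases h : (u i - a).natAbs ≤ 2
  · exact ⟨u, hu, by omega, h⟩
  · exact ⟨v, hv, by omega, by omega⟩

theorem leeDist_le_of_ediv_eq {n s : ℕ} (hs : 0 < s) (t : ℤ) {u v : Fin n → ℤ}
    (h : ∀ i, (u i + t) / (s : ℤ) = (v i + t) / (s : ℤ)) : leeDist u v ≤ n * s := by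
  have hb : ∀ i ∈ Finset.univ, (u i - v i).natAbs ≤ s := fun i _ => by
    have h1 := Int.mul_ediv_add_emod (u i + t) s
    have h2 := Int.mul_ediv_add_emod (v i + t) s
    have h3 := Int.emod_nonneg (u i + t) (b := (s : ℤ)) (by omega)
    have h4 := Int.emod_nonneg (v i + t) (b := (s : ℤ)) (by omega)
    have h5 := Int.emod_lt_of_pos (u i + t) (b := (s : ℤ)) (by omega)
    have h6 := Int.emod_lt_of_pos (v i + t) (b := (s : ℤ)) (by omega)
    rw [h i] at h1
    omega
  simpa [leeDist] using Finset.sum_le_card_nsmul _ _ _ hb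

theorem not_packing_covering {n r : ℕ} (hn : 3 ≤ n) (hr : n + 12 + 5 * (10 * n) ^ n + 5 ≤ r)
    {S : Set (Fin n → ℤ)} (h0 : 0 ∈ S)
    (hpack : ∀ u ∈ S, ∀ v ∈ S, u ≠ v → 2 * r < leeDist u v)
    (hcover : ∀ x, ∃ v ∈ S, leeDist x v ≤ r + 1) : False := by
  let i : Fin n := ⟨0, by omega⟩
  have hnear : ∀ m : Fin ((10 * n) ^ n + 1), ∃ v ∈ S, leeDist v 0 ≤ 2 * r + 6 ∧
      (v i - (5 * (m + 1) : ℕ)).natAbs ≤ 2 := fun m =>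
    exists_coord_near h0 hpack hcover (j := ⟨1, by omega⟩) (l := ⟨2, by omega⟩)
      (by simp [i]) (by simp [i]) (by simp) (by omega) (by omega)
  choose f hfS hf hfi using hnear
  let s := r / n
  have hs : 0 < s := Nat.div_pos (by omega) (by omega)
  have hns : n * s ≤ r := Nat.mul_div_le r n
  have hrs : r < n * s + n := by
    have h1 := Nat.div_add_mod r n
    have h2 := Nat.mod_lt r (show 0 < n by omega)
    change n * s + r % n = r at h1
    omega
  have hsn : n ≤ n * s := Nat.le_mul_of_pos_right n hs
  have hbound : ∀ m j, 0 ≤ (f m j + (2 * r + 6 : ℕ)) / (s : ℤ) ∧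
      (f m j + (2 * r + 6 : ℕ)) / (s : ℤ) < (10 * n : ℕ) := fun m j => by
    have h := natAbs_le_leeDist (f m) 0 j
    have h' := hf m
    simp only [Pi.zero_apply, sub_zero] at h
    refine ⟨Int.ediv_nonneg (by omega) (by omega), Int.ediv_lt_of_lt_mul (by omega) ?_⟩
    have e : ((10 * n : ℕ) : ℤ) * s = 10 * ((n * s : ℕ) : ℤ) := by
      push_cast
      ring
    rw [e]
    omega
  let box : Fin ((10 * n) ^ n + 1) → (Fin n → Fin (10 * n)) := fun m j =>
    ⟨((f m j + (2 * r + 6 : ℕ)) / (s : ℤ)).toNat, by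
      have := hbound m j
      omega⟩
  obtain ⟨m, m', hne, hbox⟩ := Fintype.exists_ne_map_eq_of_card_lt box (by simp)
  have hd : leeDist (f m) (f m') ≤ n * s :=
    leeDist_le_of_ediv_eq hs (2 * r + 6 : ℕ) fun j => by
      have h1 := congrArg Fin.val (congrFun hbox j)
      have h2 := hbound m j
      have h3 := hbound m' j
      simp only [box] at h1
      omega
  have heq : f m = f m' := by
    by_contra hff
    have := hpack _ (hfS m) _ (hfS m') hff
    omega
  have h1 := hfi m
  have h2 := hfi m'
  rw [heq] at h1
  exact hne (Fin.ext (by omega))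

theorem no_optimal_embedding_large_k (n : ℕ) (hn : 3 ≤ n) :
    ∃ kₙ : ℕ, ∀ k : ℕ, kₙ ≤ k → ¬ HasOptimalEmbedding n k := by
  let R := n + 12 + 5 * (10 * n) ^ n + 5
  refine ⟨∑ r ∈ Finset.range (R + 1), sphereCard n r, ?_⟩
  rintro k hk ⟨r, -, hkr, G, _, _, φ, -, hinj, hsurj⟩
  have hr : R ≤ r := by
    by_contra! h
    have := Finset.single_le_sum (f := sphereCard n) (fun _ _ => Nat.zero_le _)
      (Finset.mem_range.mpr (show r + 1 < R + 1 by omega))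
    omega
  exact not_packing_covering hn hr (S := {v | φ v = 0}) (map_zero φ)
    (fun u hu v hv huv => two_mul_lt_leeDist_of_injOn hinj hu hv huv)
    (exists_ker_leeDist_le_of_surjOn hsurj)
end

section
/- For every n with 7 ≤ n ≤ 12, there is no linear PL(n,2) code; equivalently, there is no subgroup L of ℤ^n such that the translates of the Lee sphere S_{n,2} by the elements of L partition ℤ^n. -/
open Set

/-- `L` is a perfect `e`-error-correcting Lee code `PL(n,e)`. -/
def IsPLCode {n : ℕ} (e : ℕ) (L : Set (Fin n → ℤ)) : Prop :=
  (∀ v ∈ L, ∀ w ∈ L, v ≠ w → 2 * e + 1 ≤ leeDist v w) ∧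
  ∀ x : Fin n → ℤ, ∃! c, c ∈ L ∧ leeDist x c ≤ e

open Finset in
/-- The Lee ball of radius `r ≤ 2` around the origin, as a finset. -/
noncomputable def leeBall (n r : ℕ) : Finset (Fin n → ℤ) :=
  {x ∈ Fintype.piFinset fun _ => Icc (-2 : ℤ) 2 | ∑ i, (x i).natAbs ≤ r}

lemma mem_leeBall {n r : ℕ} (hr : r ≤ 2) {x : Fin n → ℤ} :
    x ∈ leeBall n r ↔ ∑ i, (x i).natAbs ≤ r := by
  simp only [leeBall, Finset.mem_filter, Fintype.mem_piFinset, Finset.mem_Icc,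
    and_iff_right_iff_imp]
  intro h i
  have : (x i).natAbs ≤ ∑ i, (x i).natAbs :=
    Finset.single_le_sum (f := fun i => (x i).natAbs) (fun _ _ => Nat.zero_le _)
      (Finset.mem_univ i)
  omega

lemma sum_leeBall_zero {n : ℕ} {M : Type*} [AddCommMonoid M] (F : (Fin n → ℤ) → M) :
    ∑ x ∈ leeBall n 0, F x = F 0 := by
  have : leeBall n 0 = {0} := by
    ext x
    rw [mem_leeBall (by omega)]
    simp [funext_iff]
  rw [this, Finset.sum_singleton]

lemma sum_leeBall_succ {n r : ℕ} (hr : r ≤ 2) {M : Type*} [AddCommMonoid M]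
    (F : (Fin (n + 1) → ℤ) → M) :
    ∑ x ∈ leeBall (n + 1) r, F x =
      ∑ a ∈ Finset.Icc (-(r : ℤ)) r, ∑ x ∈ leeBall n (r - a.natAbs), F (Fin.cons a x) := by
  rw [Finset.sum_sigma']
  symm
  refine Finset.sum_bij' (fun y _ => Fin.cons y.1 y.2) (fun x _ => ⟨x 0, Fin.tail x⟩)
    ?_ ?_ ?_ ?_ ?_
  · rintro ⟨a, x⟩ h
    simp only [Finset.mem_sigma, Finset.mem_Icc] at h
    rw [mem_leeBall (by omega)] at h
    rw [mem_leeBall hr]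
    simp only [Fin.sum_univ_succ, Fin.cons_zero, Fin.cons_succ]
    omega
  · intro x h
    rw [mem_leeBall hr, Fin.sum_univ_succ] at h
    simp only [Finset.mem_sigma, Finset.mem_Icc]
    rw [mem_leeBall (by omega)]
    simp only [Fin.tail]
    omega
  · rintro ⟨a, x⟩ _
    simp
  · intro x _
    simp
  · intro x _
    rfl

section BallSums

variable {A R : Type*} [AddCommGroup A] [CommRing R]

lemma sum_leeBall_one {n : ℕ} (g : Fin n → A) (h : A → R) (c : A) :
    ∑ x ∈ leeBall n 1, h (c + ∑ i, x i • g i) =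
      h c + ∑ i, (h (c + g i) + h (c - g i)) := by
  induction n with
  | zero =>
    have : leeBall 0 1 = {0} := by
      ext x
      rw [mem_leeBall (by omega)]
      simp [Subsingleton.elim x 0]
    simp [this]
  | succ n ih =>
    have hI : Finset.Icc (-((1 : ℕ) : ℤ)) (1 : ℕ) = {-1, 0, 1} := by decide
    have ih := ih (fun i => g i.succ)
    rw [sum_leeBall_succ (by omega), hI]
    simp [Fin.sum_univ_succ, sum_leeBall_zero, ih, ← sub_eq_add_neg]
    ring

/-- The sum over the Lee ball of radius two, every point of norm two being counted as an ordered
sum of two signed unit vectors. -/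
lemma sum_leeBall_two {n : ℕ} (g : Fin n → A) (h : A → R) (c : A) :
    2 * ∑ x ∈ leeBall n 2, h (c + ∑ i, x i • g i) + 2 * n * h c =
      2 * h c + 2 * ∑ i, (h (c + g i) + h (c - g i)) +
      ∑ i, (h (c + g i + g i) + h (c - g i - g i)) +
      ∑ i, ∑ j, (h (c + g i + g j) + h (c + g i - g j) +
        (h (c - g i + g j) + h (c - g i - g j))) := by
  induction n with
  | zero =>
    have : leeBall 0 2 = {0} := by
      ext x
      rw [mem_leeBall (by omega)]
      simp [Subsingleton.elim x 0]
    simp [this]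
  | succ n ih =>
    have hI : Finset.Icc (-((2 : ℕ) : ℤ)) (2 : ℕ) = {-2, -1, 0, 1, 2} := by decide
    have ih := ih (fun i => g i.succ)
    have h1 := fun c => sum_leeBall_one (fun i => g i.succ) h c
    rw [sum_leeBall_succ (by omega), hI]
    simp only [Fin.sum_univ_succ]
    have e1 : ∀ i : Fin n, c - g 0 + g i.succ = c + g i.succ - g 0 := fun i => by abel
    have e2 : ∀ i : Fin n, c - g 0 - g i.succ = c - g i.succ - g 0 := fun i => by abel
    have e3 : ∀ i : Fin n, c + g 0 + g i.succ = c + g i.succ + g 0 := fun i => by abel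
    have e4 : ∀ i : Fin n, c + g 0 - g i.succ = c - g i.succ + g 0 := fun i => by abel
    have e5 : c + (2 : ℤ) • g 0 = c + g 0 + g 0 := by rw [two_zsmul]; abel
    have e6 : c + -((2 : ℤ) • g 0) = c - g 0 - g 0 := by rw [two_zsmul]; abel
    simp [sum_leeBall_zero, ← add_assoc, h1, e5, e6, ← sub_eq_add_neg, Finset.sum_add_distrib,
      e1, e2, e3, e4] at ih ⊢
    linear_combination ih

end BallSums

lemma card_leeBall_two (n : ℕ) : (leeBall n 2).card = 2 * n ^ 2 + 2 * n + 1 := by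
  have h := sum_leeBall_two (A := ℤ) (R := ℤ) (n := n) (fun _ => 0) (fun _ => 1) 0
  simp only [Finset.sum_const, Finset.card_univ, Fintype.card_fin, nsmul_eq_mul] at h
  zify
  linarith

/-- Sums of powers over all ordered sums of two terms, in terms of power sums. -/
lemma sum_sum_add_pow {ι R : Type*} [Fintype ι] [CommRing R] (u : ι → R) (K : ℕ) :
    ∑ i, ∑ j, (u i + u j) ^ K =
      ∑ m ∈ Finset.range (K + 1), K.choose m * ((∑ i, u i ^ m) * ∑ i, u i ^ (K - m)) := by
  simp only [add_pow, Finset.sum_mul_sum]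
  simp only [Finset.mul_sum]
  rw [Finset.sum_comm' (t' := Finset.univ) (s' := fun _ => Finset.range (K + 1)) (by simp)]
  refine Finset.sum_congr rfl fun i _ => ?_
  rw [Finset.sum_comm]
  exact Finset.sum_congr rfl fun m _ => Finset.sum_congr rfl fun j _ => by ring

lemma exists_surjective_dual {K V : Type*} [Field K] [AddCommGroup V] [Module K V] {y : V}
    (hy : y ≠ 0) : ∃ f : V →+ K, Function.Surjective f := by
  obtain ⟨l, hl⟩ : ∃ l : Module.Dual K V, l y ≠ 0 := by
    by_contra! hall
    exact hy ((Module.forall_dual_apply_eq_zero_iff K y).1 hall)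
  have hl0 : l ≠ 0 := fun h0 => hl (by simp [h0])
  exact ⟨l.toAddMonoidHom, LinearMap.surjective hl0⟩

lemma exists_surjective_zmod {G : Type*} [AddCommGroup G] [Finite G] (p : ℕ) [hp : Fact p.Prime]
    (h : p ∣ Nat.card G) : ∃ f : G →+ ZMod p, Function.Surjective f := by
  let φ : G →+ G := nsmulAddMonoidHom p
  have hQ : ∀ q : G ⧸ φ.range, p • q = 0 := by
    intro q
    obtain ⟨x, rfl⟩ := QuotientAddGroup.mk_surjective q
    exact (QuotientAddGroup.eq_zero_iff (N := φ.range) (p • x)).2 ⟨x, rfl⟩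
  obtain ⟨x, hx⟩ := exists_prime_addOrderOf_dvd_card' p h
  have hφ : ¬ Function.Surjective φ := fun hs => by
    have hinj := Finite.injective_iff_surjective.2 hs
    have : x = 0 := hinj (by simp [φ, ← hx])
    rw [this, addOrderOf_zero] at hx
    exact hp.out.one_lt.ne hx
  obtain ⟨y, hy⟩ : ∃ y, y ∉ φ.range := by
    by_contra! hall
    exact hφ fun y => hall y
  let _ : Module (ZMod p) (G ⧸ φ.range) := AddCommGroup.zmodModule hQ
  obtain ⟨f, hf⟩ := exists_surjective_dual (K := ZMod p)
    (y := (y : G ⧸ φ.range)) fun h0 => hy ((QuotientAddGroup.eq_zero_iff y).1 h0)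
  exact ⟨f.comp (QuotientAddGroup.mk' φ.range), hf.comp QuotientAddGroup.mk_surjective⟩

lemma card_fiber_of_surjective {G H : Type*} [AddGroup G] [AddGroup H] [Fintype G] [Fintype H]
    [DecidableEq H] (f : G →+ H) (hf : Function.Surjective f) (m : ℕ)
    (hm : Fintype.card G = m * Fintype.card H) (y : H) :
    (Finset.univ.filter fun x => f x = y).card = m := by
  have hc : ∀ z, (Finset.univ.filter fun x => f x = z).card =
      (Finset.univ.filter fun x => f x = y).card := fun z =>
    AddMonoidHom.card_fiber_eq_of_mem_range f (hf z) (hf y)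
  have h1 := Finset.card_eq_sum_card_fiberwise (f := f) (s := Finset.univ) (t := Finset.univ)
    (by simp)
  simp only [hc, Finset.sum_const, Finset.card_univ, hm, smul_eq_mul] at h1
  rw [mul_comm] at h1
  exact (Nat.eq_of_mul_eq_mul_left Fintype.card_pos h1).symm

/-- A lattice tiling by Lee balls yields, for each prime divisor `p` of the size of the ball, a
linear form modulo `p` which is equidistributed on the ball. -/
lemma exists_equidistributed_form {n : ℕ} (p m : ℕ) [Fact p.Prime]
    (hN : 2 * n ^ 2 + 2 * n + 1 = m * p) (L : AddSubgroup (Fin n → ℤ))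
    (hL : ∀ x : Fin n → ℤ, ∃! l, l ∈ L ∧ x - l ∈ leeSphere n 2) :
    ∃ g : Fin n → ZMod p, ∀ y,
      ((leeBall n 2).filter fun x => ∑ i, x i • g i = y).card = m := by
  classical
  have hmem : ∀ x : Fin n → ℤ, x ∈ leeSphere n 2 ↔ x ∈ leeBall n 2 := fun x => by
    simp [mem_leeBall, leeSphere, leeDist]
  let π : (Fin n → ℤ) →+ (Fin n → ℤ) ⧸ L := QuotientAddGroup.mk' L
  have hsurj : ∀ q, ∃ x ∈ leeBall n 2, π x = q := by
    intro q
    obtain ⟨x, rfl⟩ := QuotientAddGroup.mk_surjective q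
    obtain ⟨l, ⟨hl, hx⟩, -⟩ := hL x
    refine ⟨x - l, (hmem _).1 hx, ?_⟩
    rw [map_sub, show π l = 0 from (QuotientAddGroup.eq_zero_iff l).2 hl, sub_zero]
    rfl
  have hinj : Set.InjOn π (leeBall n 2) := by
    intro x hx y hy hxy
    have hxy' : x - y ∈ L := by
      rw [← QuotientAddGroup.eq_zero_iff]
      exact (map_sub π x y).trans (sub_eq_zero.2 hxy)
    have := (hL x).unique ⟨L.zero_mem, by simpa [hmem] using hx⟩ ⟨hxy', by simpa [hmem] using hy⟩
    exact (sub_eq_zero.1 this.symm)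
  have himage : π '' (leeBall n 2) = Set.univ := by
    ext q
    simpa using hsurj q
  have hfin : Finite ((Fin n → ℤ) ⧸ L) :=
    Set.finite_univ_iff.1 (himage ▸ (leeBall n 2).finite_toSet.image π)
  have := Fintype.ofFinite ((Fin n → ℤ) ⧸ L)
  have hcount (s : Finset ((Fin n → ℤ) ⧸ L)) :
      ((leeBall n 2).filter fun x => π x ∈ s).card = s.card := by
    refine Finset.card_nbij π (fun x hx => (Finset.mem_filter.1 hx).2)
      (hinj.mono fun x hx => (Finset.mem_filter.1 hx).1) fun q hq => ?_
    obtain ⟨x, hx, rfl⟩ := hsurj q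
    exact ⟨x, by simpa [hx] using hq, rfl⟩
  have hcard : Fintype.card ((Fin n → ℤ) ⧸ L) = m * p := by
    rw [← hN, ← card_leeBall_two, ← Finset.card_univ, ← hcount]
    simp
  obtain ⟨f, hf⟩ := exists_surjective_zmod (G := (Fin n → ℤ) ⧸ L) p
    (by simp [hcard])
  refine ⟨fun i => f (π (Pi.single i 1)), fun y => ?_⟩
  rw [← card_fiber_of_surjective f hf m (by simpa using hcard) y, ← hcount]
  congr 1
  refine Finset.filter_congr fun x _ => ?_
  have hx : π x = ∑ i, x i • π (Pi.single i 1) := by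
    simp only [← map_zsmul, ← map_sum, ← Pi.single_smul, smul_eq_mul, mul_one,
      Finset.univ_sum_single]
  simp [hx]

/-- The `k`-th power sum of the family consisting of all `g i` and all `-g i`. -/
def signedPowerSum {n : ℕ} {R : Type*} [CommRing R] (g : Fin n → R) (k : ℕ) : R :=
  ∑ s, (Sum.elim g (-g) s) ^ k

section SignedPowerSum

variable {n : ℕ} {R : Type*} [CommRing R] (g : Fin n → R)

lemma signedPowerSum_zero : signedPowerSum g 0 = 2 * n := by
  simp [signedPowerSum]
  ring

lemma signedPowerSum_even {k : ℕ} (hk : Even k) : signedPowerSum g k = 2 * ∑ i, g i ^ k := by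
  simp [signedPowerSum, hk.neg_pow]
  ring

lemma signedPowerSum_odd {k : ℕ} (hk : Odd k) : signedPowerSum g k = 0 := by
  simp [signedPowerSum, hk.neg_pow]

/-- If the mixed products vanish, the sum of `k`-th powers over the Lee ball is a multiple of a
single signed power sum. -/
lemma two_mul_sum_leeBall_pow {k : ℕ} (hk : 0 < k)
    (hcross : ∀ j, 0 < j → j < k → signedPowerSum g j * signedPowerSum g (k - j) = 0) :
    2 * ∑ x ∈ leeBall n 2, (∑ i, x i • g i) ^ k =
      ((2 + 2 ^ k + 4 * n : ℕ) : R) * signedPowerSum g k := by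
  have h := sum_leeBall_two g (fun y => y ^ k) 0
  have h2 := sum_sum_add_pow (Sum.elim g (-g)) k
  change _ = ∑ m ∈ Finset.range (k + 1), (k.choose m : R) *
    (signedPowerSum g m * signedPowerSum g (k - m)) at h2
  have h3 : ∑ m ∈ Finset.range (k + 1), (k.choose m : R) *
      (signedPowerSum g m * signedPowerSum g (k - m)) = 4 * n * signedPowerSum g k := by
    obtain ⟨k, rfl⟩ := Nat.exists_eq_succ_of_ne_zero hk.ne'
    rw [Finset.sum_range_succ, Finset.sum_range_succ', Finset.sum_eq_zero]
    · simp [signedPowerSum_zero]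
      ring
    · intro j hj
      rw [hcross _ (by omega) (by simpa using hj), mul_zero]
  rw [h3] at h2
  have h4 : ∀ y : R, (y + y) ^ k = 2 ^ k * y ^ k := fun y => by rw [← two_mul, mul_pow]
  have h5 : ∀ y : R, (-y - y) ^ k = 2 ^ k * (-y) ^ k := fun y => by
    rw [← h4, sub_eq_add_neg]
  simp only [Fintype.sum_sum_type, Sum.elim_inl, Sum.elim_inr, Pi.neg_apply, ← sub_eq_add_neg,
    Finset.sum_add_distrib] at h2
  simp only [zero_add, zero_sub, zero_pow hk.ne', mul_zero, add_zero, h4, h5,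
    Finset.sum_add_distrib, ← Finset.mul_sum] at h
  push_cast
  rw [h]
  simp only [signedPowerSum, Fintype.sum_sum_type, Sum.elim_inl, Sum.elim_inr, Pi.neg_apply] at h2 ⊢
  linear_combination h2

end SignedPowerSum

section Equidistributed

variable {n p m : ℕ} [Fact p.Prime] {g : Fin n → ZMod p}

lemma sum_leeBall_pow_of_equidistributed
    (hg : ∀ y, ((leeBall n 2).filter fun x => ∑ i, x i • g i = y).card = m) (k : ℕ) :
    ∑ x ∈ leeBall n 2, (∑ i, x i • g i) ^ k = m * ∑ y : ZMod p, y ^ k := by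
  rw [← Finset.sum_fiberwise (s := leeBall n 2) (g := fun x => ∑ i, x i • g i), Finset.mul_sum]
  refine Finset.sum_congr rfl fun y _ => ?_
  rw [Finset.sum_congr rfl (g := fun _ => y ^ k) fun x hx => by rw [(Finset.mem_filter.1 hx).2],
    Finset.sum_const, hg, nsmul_eq_mul]

lemma signedPowerSum_eq_zero_of_equidistributed
    (hg : ∀ y, ((leeBall n 2).filter fun x => ∑ i, x i • g i = y).card = m) (d M : ℕ)
    (hM : M ≤ p - 1)
    (hcoef : ∀ k < M, 0 < k → Even k → ¬ d ∣ k → ¬ p ∣ 2 + 2 ^ k + 4 * n)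
    (k : ℕ) (hk : 0 < k) (hkM : k < M) (hd : ¬ d ∣ k) : signedPowerSum g k = 0 := by
  induction k using Nat.strong_induction_on with
  | _ k ih =>
    rcases Nat.even_or_odd k with he | ho
    · have hcross : ∀ j, 0 < j → j < k → signedPowerSum g j * signedPowerSum g (k - j) = 0 := by
        intro j hj hjk
        by_cases hdj : d ∣ j
        · rw [ih (k - j) (by omega) (by omega) (by omega)
            fun h => hd ((Nat.dvd_sub_iff_left hjk.le hdj).1 h), mul_zero]
        · rw [ih j hjk hj (by omega) hdj, zero_mul]
      have h := two_mul_sum_leeBall_pow g hk hcross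
      rw [sum_leeBall_pow_of_equidistributed hg,
        FiniteField.sum_pow_lt_card_sub_one (ZMod p) k (by rw [ZMod.card]; omega), mul_zero, mul_zero] at h
      refine (mul_eq_zero.1 h.symm).resolve_left fun h0 => ?_
      exact hcoef k hkM hk he hd ((ZMod.natCast_eq_zero_iff _ _).1 h0)
    · exact signedPowerSum_odd g ho

/-- The identity for exponent `p - 1`, where the power sum counts the nonzero coefficients. -/
lemma exists_count_of_equidistributed
    (hg : ∀ y, ((leeBall n 2).filter fun x => ∑ i, x i • g i = y).card = m) (d : ℕ)
    (hp : p ≠ 2)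
    (hcoef : ∀ k < p - 1, 0 < k → Even k → ¬ d ∣ k → ¬ p ∣ 2 + 2 ^ k + 4 * n)
    (hd : ∀ j < p - 1, 0 < j → ¬ d ∣ j ∨ ¬ d ∣ p - 1 - j) :
    ∃ c ≤ n, p ∣ m + (3 + 4 * n) * c := by
  have hp1 : 0 < p - 1 := Nat.sub_pos_of_lt (Fact.out (p := p.Prime)).one_lt
  have hz := signedPowerSum_eq_zero_of_equidistributed hg d (p - 1) le_rfl hcoef
  have hcross : ∀ j, 0 < j → j < p - 1 →
      signedPowerSum g j * signedPowerSum g (p - 1 - j) = 0 := by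
    intro j hj hjp
    rcases hd j hjp hj with h | h
    · rw [hz j hj hjp h, zero_mul]
    · rw [hz _ (by omega) (by omega) h, mul_zero]
  have h := two_mul_sum_leeBall_pow g hp1 hcross
  have heven : Even (p - 1) := (Fact.out (p := p.Prime)).even_sub_one hp
  have hpow : ∀ y : ZMod p, y ^ (p - 1) = if y ≠ 0 then 1 else 0 := by
    intro y
    split_ifs with hy
    · exact ZMod.pow_card_sub_one_eq_one hy
    · rw [not_not.1 hy, zero_pow hp1.ne']
  have hsum : ∑ y : ZMod p, y ^ (p - 1) = -1 := by
    simp only [hpow, Finset.sum_boole, Finset.filter_ne', Finset.card_erase_of_mem,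
      Finset.mem_univ, Finset.card_univ, ZMod.card]
    rw [Nat.cast_sub (by omega)]
    simp
  have h2 : (2 : ZMod p) ≠ 0 := fun h0 => by
    have := (ZMod.natCast_eq_zero_iff 2 p).1 (by exact_mod_cast h0)
    exact hp ((Nat.prime_dvd_prime_iff_eq Fact.out Nat.prime_two).1 this)
  rw [sum_leeBall_pow_of_equidistributed hg, hsum, signedPowerSum_even g heven] at h
  simp only [hpow (g _), Finset.sum_boole] at h
  refine ⟨_, (Finset.card_filter_le Finset.univ fun i => g i ≠ 0).trans_eq (by simp), ?_⟩
  rw [← ZMod.natCast_eq_zero_iff]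
  push_cast [ZMod.pow_card_sub_one_eq_one h2] at h ⊢
  apply mul_left_cancel₀ h2
  linear_combination -h

/-- A form that is bijective on the ball cannot have all its low even power sums forced to vanish. -/
lemma false_of_equidistributed_one
    (hg : ∀ y, ((leeBall n 2).filter fun x => ∑ i, x i • g i = y).card = 1)
    (hn : 0 < n) (hnp : 2 * n + 1 ≤ p - 1)
    (hcoef : ∀ k < 2 * n + 1, 0 < k → Even k → ¬ p ∣ 2 + 2 ^ k + 4 * n) : False := by
  have h2 : (2 : ZMod p) ≠ 0 := fun h0 => by
    have := Nat.le_of_dvd two_pos ((ZMod.natCast_eq_zero_iff 2 p).1 (by exact_mod_cast h0))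
    omega
  have hn0 : (n : ZMod p) ≠ 0 := fun h0 => by
    have := Nat.le_of_dvd hn ((ZMod.natCast_eq_zero_iff n p).1 h0)
    omega
  have hS : ∀ k, 0 < k → k ≤ n → ∑ i, (g i ^ 2) ^ k = 0 := by
    intro k hk hkn
    have h := signedPowerSum_eq_zero_of_equidistributed hg 0 (2 * n + 1) hnp
      (fun k hk h0 he _ => hcoef k hk h0 he) (2 * k) (by omega) (by omega) (by simp; omega)
    rw [signedPowerSum_even g (even_two_mul k)] at h
    simpa [pow_mul] using (mul_eq_zero.1 h).resolve_left h2
  have hN := congrArg (MvPolynomial.aeval fun i => g i ^ 2)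
    (MvPolynomial.mul_esymm_eq_sum (Fin n) (ZMod p) n)
  have hprod : MvPolynomial.aeval (fun i => g i ^ 2) (MvPolynomial.esymm (Fin n) (ZMod p) n) =
      ∏ i, g i ^ 2 := by
    have hc : Finset.powersetCard n (Finset.univ : Finset (Fin n)) = {Finset.univ} := by
      simpa using Finset.powersetCard_self (Finset.univ : Finset (Fin n))
    simp [MvPolynomial.esymm, hc]
  rw [map_mul, hprod, map_mul, map_sum, Finset.sum_eq_zero, mul_zero, map_natCast] at hN
  · obtain ⟨i, -, hi⟩ := Finset.prod_eq_zero_iff.1 ((mul_eq_zero.1 hN).resolve_left hn0)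
    have hi0 : g i = 0 := by simpa using hi
    obtain ⟨x, hx⟩ := Finset.card_eq_one.1 (hg 0)
    have hx0 : (0 : Fin n → ℤ) = x := by
      rw [← Finset.mem_singleton, ← hx, Finset.mem_filter, mem_leeBall le_rfl]
      simp
    have hx1 : (Pi.single i 1 : Fin n → ℤ) = x := by
      rw [← Finset.mem_singleton, ← hx, Finset.mem_filter, mem_leeBall le_rfl]
      constructor
      · rw [Finset.sum_eq_single i] <;> simp +contextual
      · rw [Finset.sum_eq_single i] <;> simp +contextual [hi0]
    simpa using congrFun (hx1.trans hx0.symm) i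
  · rintro ⟨a, b⟩ hab
    rw [Finset.mem_filter, Finset.HasAntidiagonal.mem_antidiagonal] at hab
    dsimp only at hab
    have hb : MvPolynomial.aeval (fun i => g i ^ 2) (MvPolynomial.psum (Fin n) (ZMod p) b) = 0 := by
      simpa [MvPolynomial.psum] using hS b (by omega) (by omega)
    rw [map_mul, hb, mul_zero]

end Equidistributed

lemma not_tiling (n : ℕ) (h₇ : 7 ≤ n) (h₁₂ : n ≤ 12) (L : AddSubgroup (Fin n → ℤ)) :
    ¬ ∀ x : Fin n → ℤ, ∃! l, l ∈ L ∧ x - l ∈ leeSphere n 2 := by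
  intro hL
  interval_cases n
  · have : Fact (Nat.Prime 113) := ⟨by norm_num⟩
    obtain ⟨g, hg⟩ := exists_equidistributed_form 113 1 (by norm_num) L hL
    exact false_of_equidistributed_one hg (by norm_num) (by norm_num) (by decide)
  · have : Fact (Nat.Prime 5) := ⟨by norm_num⟩
    obtain ⟨g, hg⟩ := exists_equidistributed_form 5 29 (by norm_num) L hL
    exact absurd (exists_count_of_equidistributed hg 4 (by norm_num) (by decide) (by decide))
      (by decide)
  · have : Fact (Nat.Prime 181) := ⟨by norm_num⟩
    obtain ⟨g, hg⟩ := exists_equidistributed_form 181 1 (by norm_num) L hL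
    exact false_of_equidistributed_one hg (by norm_num) (by norm_num) (by decide)
  · have : Fact (Nat.Prime 13) := ⟨by norm_num⟩
    obtain ⟨g, hg⟩ := exists_equidistributed_form 13 17 (by norm_num) L hL
    exact absurd (exists_count_of_equidistributed hg 10 (by norm_num) (by decide) (by decide))
      (by decide)
  · have : Fact (Nat.Prime 53) := ⟨by norm_num⟩
    obtain ⟨g, hg⟩ := exists_equidistributed_form 53 5 (by norm_num) L hL
    exact absurd (exists_count_of_equidistributed hg 14 (by norm_num) (by decide) (by decide))
      (by decide)
  · have : Fact (Nat.Prime 313) := ⟨by norm_num⟩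
    obtain ⟨g, hg⟩ := exists_equidistributed_form 313 1 (by norm_num) L hL
    exact false_of_equidistributed_one hg (by norm_num) (by norm_num) (by decide)

theorem no_linear_PL_n_2 (n : ℕ) (h₇ : 7 ≤ n) (h₁₂ : n ≤ 12) :
    (¬ ∃ L : AddSubgroup (Fin n → ℤ), IsPLCode 2 (L : Set (Fin n → ℤ))) ∧
    (¬ ∃ L : AddSubgroup (Fin n → ℤ),
        ∀ x : Fin n → ℤ, ∃! l, l ∈ L ∧ x - l ∈ leeSphere n 2) := by
  refine ⟨?_, fun ⟨L, hL⟩ => not_tiling n h₇ h₁₂ L hL⟩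
  rintro ⟨L, -, hL⟩
  refine not_tiling n h₇ h₁₂ L fun x => ?_
  simpa [leeSphere, leeDist] using hL x
end

section
/- Let 7 ≤ n ≤ 12 and k = 2n² + 2n + 1. Then for every n-tuple (g₁,…,g_n) of elements of ℤ/kℤ, the set {±g_i : 1 ≤ i ≤ n} ∪ {±g_i ± g_j : 1 ≤ i ≤ j ≤ n} (all four sign choices) has fewer than 2n² + 2n + 1 elements; equivalently, no group homomorphism φ : ℤ^n → ℤ/kℤ restricts to a bijection on the Lee sphere S_{n,2}. -/
open Set

open scoped Finset

/-- The values `0`, `±g i`, `±(g i + g j)` for `i ≤ j` and `±(g i - g j)` for `j < i`, indexed by a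
type with `2 * n ^ 2 + 2 * n + 1` elements. -/
def sphereValue {n : ℕ} {A : Type*} [AddCommGroup A] (g : Fin n → A) :
    Option ((Fin n ⊕ Fin n × Fin n) × Bool) → A
  | none => 0
  | some (.inl i, b) => if b then g i else -g i
  | some (.inr (i, j), b) =>
    if b then (if i ≤ j then g i + g j else g i - g j)
    else -(if i ≤ j then g i + g j else g i - g j)

/-- The set `{±g i} ∪ {±g i ± g j : i ≤ j}`. -/
def sphereValues {n : ℕ} {A : Type*} [AddCommGroup A] (g : Fin n → A) : Set A :=
  {x | ∃ i : Fin n, x = g i ∨ x = -g i} ∪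
    {x | ∃ i j : Fin n, i ≤ j ∧
      (x = g i + g j ∨ x = g i - g j ∨ x = -g i + g j ∨ x = -g i - g j)}

theorem sphereValues_subset_range {n : ℕ} {A : Type*} [AddCommGroup A] (g : Fin n → A) :
    sphereValues g ⊆ range (sphereValue g) := by
  rintro x (⟨i, rfl | rfl⟩ | ⟨i, j, hij, h⟩)
  · exact ⟨some (.inl i, true), by simp [sphereValue]⟩
  · exact ⟨some (.inl i, false), by simp [sphereValue]⟩
  · rcases hij.eq_or_lt with rfl | hlt
    · rcases h with rfl | rfl | rfl | rfl
      · exact ⟨some (.inr (i, i), true), by simp [sphereValue]⟩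
      · exact ⟨none, by simp [sphereValue]⟩
      · exact ⟨none, by simp [sphereValue]⟩
      · exact ⟨some (.inr (i, i), false), by simp [sphereValue, sub_eq_add_neg]⟩
    · have hji : ¬ j ≤ i := not_le.mpr hlt
      rcases h with rfl | rfl | rfl | rfl
      · exact ⟨some (.inr (i, j), true), by simp [sphereValue, hij]⟩
      · exact ⟨some (.inr (j, i), false), by simp [sphereValue, hji]⟩
      · exact ⟨some (.inr (j, i), true), by simp [sphereValue, hji, sub_eq_add_neg, add_comm]⟩
      · exact ⟨some (.inr (i, j), false), by simp [sphereValue, hij, sub_eq_add_neg, add_comm]⟩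

theorem card_sphereValue_index (n : ℕ) :
    Fintype.card (Option ((Fin n ⊕ Fin n × Fin n) × Bool)) = 2 * n ^ 2 + 2 * n + 1 := by
  simp only [Fintype.card_option, Fintype.card_prod, Fintype.card_sum, Fintype.card_fin,
    Fintype.card_bool]
  ring

/-- Twice the sum of `A` on and above the diagonal and `B` below it, for symmetric `A` and `B`. -/
theorem two_mul_sum_ite_le {n : ℕ} {R : Type*} [CommRing R] (A B : Fin n → Fin n → R)
    (hA : ∀ i j, A i j = A j i) (hB : ∀ i j, B i j = B j i) :
    2 * ∑ i, ∑ j, (if i ≤ j then A i j else B i j) =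
      ∑ i, ∑ j, (A i j + B i j) + ∑ i, (A i i - B i i) := by
  have hdiag : ∑ i, (A i i - B i i) = ∑ i, ∑ j, (if i = j then A i j - B i j else 0) := by
    simp
  rw [two_mul]
  nth_rewrite 2 [Finset.sum_comm]
  rw [hdiag, ← Finset.sum_add_distrib, ← Finset.sum_add_distrib]
  refine Finset.sum_congr rfl fun i _ => ?_
  rw [← Finset.sum_add_distrib, ← Finset.sum_add_distrib]
  refine Finset.sum_congr rfl fun j _ => ?_
  rcases lt_trichotomy i j with h | rfl | h
  · simp [h.le, not_le.mpr h, h.ne, hB j i]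
  · simp
  · simp [h.le, not_le.mpr h, h.ne', hA j i, add_comm]

/-- If all products of lower even power sums vanish, then the double sum of the `2m`-th powers
of `g i ± g j` reduces to its two extreme terms. -/
theorem sum_add_pow_add_sub_pow {n : ℕ} {R : Type*} [CommRing R] (g : Fin n → R) {m : ℕ}
    (hm : 0 < m)
    (hprod : ∀ s, 0 < s → s < m → (∑ i, g i ^ (2 * s)) * ∑ i, g i ^ (2 * (m - s)) = 0) :
    ∑ i, ∑ j, ((g i + g j) ^ (2 * m) + (g i - g j) ^ (2 * m)) =
      4 * n * ∑ i, g i ^ (2 * m) := by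
  have hexpand : ∀ i j, (g i + g j) ^ (2 * m) + (g i - g j) ^ (2 * m) =
      ∑ t ∈ Finset.range (2 * m + 1),
        (1 + (-1) ^ (2 * m - t)) * ((2 * m).choose t : R) * (g i ^ t * g j ^ (2 * m - t)) := by
    intro i j
    rw [sub_eq_add_neg, add_pow, add_pow, ← Finset.sum_add_distrib]
    refine Finset.sum_congr rfl fun t _ => ?_
    rw [neg_pow (g j)]
    ring
  have hswap : ∑ i, ∑ j, ((g i + g j) ^ (2 * m) + (g i - g j) ^ (2 * m)) =
      ∑ t ∈ Finset.range (2 * m + 1), (1 + (-1) ^ (2 * m - t)) * ((2 * m).choose t : R) *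
        ((∑ i, g i ^ t) * ∑ j, g j ^ (2 * m - t)) := by
    simp_rw [hexpand]
    simp_rw [Finset.sum_comm (s := Finset.univ) (t := Finset.range (2 * m + 1))]
    refine Finset.sum_congr rfl fun t _ => ?_
    rw [Finset.sum_mul_sum, Finset.mul_sum]
    simp_rw [Finset.mul_sum]
  rw [hswap, Finset.sum_eq_add_of_mem 0 (2 * m) (by simp) (by simp) (by omega)]
  · simp [pow_mul]
    ring
  · rintro t ht ⟨h0, h1⟩
    have ht : t < 2 * m + 1 := Finset.mem_range.mp ht
    rcases Nat.even_or_odd' t with ⟨s, rfl | rfl⟩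
    · rw [← Nat.mul_sub, hprod s (by omega) (by omega), mul_zero]
    · have hodd : Odd (2 * m - (2 * s + 1)) := ⟨m - s - 1, by omega⟩
      rw [hodd.neg_one_pow]
      simp

/-- The sum of the `2m`-th powers of the sphere values, when products of lower even power sums
vanish. -/
theorem sum_sphereValue_pow {n : ℕ} {R : Type*} [CommRing R] (g : Fin n → R) {m : ℕ}
    (hm : 0 < m)
    (hprod : ∀ s, 0 < s → s < m → (∑ i, g i ^ (2 * s)) * ∑ i, g i ^ (2 * (m - s)) = 0) :
    ∑ t, sphereValue g t ^ (2 * m) = (4 * n + 2 + 4 ^ m) * ∑ i, g i ^ (2 * m) := by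
  have heven : Even (2 * m) := even_two_mul m
  have hdouble := two_mul_sum_ite_le (fun i j => (g i + g j) ^ (2 * m))
    (fun i j => (g i - g j) ^ (2 * m)) (fun i j => by rw [add_comm])
    (fun i j => by rw [← heven.neg_pow, neg_sub])
  rw [sum_add_pow_add_sub_pow g hm hprod] at hdouble
  have hdiag : ∑ i, ((g i + g i) ^ (2 * m) - (g i - g i) ^ (2 * m)) =
      4 ^ m * ∑ i, g i ^ (2 * m) := by
    rw [Finset.mul_sum]
    refine Finset.sum_congr rfl fun i _ => ?_
    rw [sub_self, zero_pow (by omega), sub_zero, ← two_mul, mul_pow, pow_mul 2 2 m]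
    norm_num
  rw [hdiag] at hdouble
  have hmain : ∑ t, sphereValue g t ^ (2 * m) = 2 * ∑ i, g i ^ (2 * m) +
      2 * ∑ i, ∑ j, (if i ≤ j then (g i + g j) ^ (2 * m) else (g i - g j) ^ (2 * m)) := by
    simp only [Fintype.sum_option, Fintype.sum_prod_type, Fintype.sum_sum_type, Fintype.sum_bool,
      sphereValue, if_true, Bool.false_eq_true, if_false, heven.neg_pow, ite_pow, ← two_mul,
      ← Finset.mul_sum]
    rw [zero_pow (by omega), zero_add]
  rw [hmain, hdouble]
  ring

theorem map_sphereValue {n : ℕ} {A B : Type*} [AddCommGroup A] [AddCommGroup B] (f : A →+ B)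
    (g : Fin n → A) (t : Option ((Fin n ⊕ Fin n × Fin n) × Bool)) :
    f (sphereValue g t) = sphereValue (fun i => f (g i)) t := by
  rcases t with _ | ⟨i | ⟨i, j⟩, b⟩
  · exact map_zero f
  all_goals
    simp only [sphereValue]
    split_ifs <;> simp only [map_neg, map_add, map_sub]

theorem sum_castHom {p c : ℕ} [NeZero p] [NeZero (p * c)] {R : Type*} [CommRing R]
    (f : ZMod p → R) :
    ∑ x : ZMod (p * c), f (ZMod.castHom (Dvd.intro c rfl) (ZMod p) x) = c * ∑ y, f y := by
  set q := ZMod.castHom (Dvd.intro c rfl : p ∣ p * c) (ZMod p)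
  have hsurj : Function.Surjective q := ZMod.castHom_surjective _
  have hconst : ∀ y, #{x | q x = y} = #{x | q x = 0} := fun y =>
    AddMonoidHom.card_fiber_eq_of_mem_range q (hsurj y) (hsurj 0)
  have hcard : p * #{x | q x = 0} = p * c := by
    have h := Finset.card_eq_sum_card_fiberwise (f := q) (s := Finset.univ) (t := Finset.univ)
      (by simp)
    simp only [hconst, Finset.sum_const, Finset.card_univ, ZMod.card, smul_eq_mul] at h
    exact h.symm
  have hc : #{x | q x = 0} = c := Nat.eq_of_mul_eq_mul_left (NeZero.pos p) hcard
  rw [Finset.sum_comp, Finset.image_univ_of_surjective hsurj, Finset.mul_sum]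
  simp [hconst, hc]

theorem sum_pow_sub_one_eq_neg_one (p : ℕ) [Fact p.Prime] :
    ∑ x : ZMod p, x ^ (p - 1) = -1 := by
  have hp := (Fact.out : p.Prime)
  have h : ∀ x : ZMod p, x ^ (p - 1) = 1 - if x = 0 then 1 else 0 := by
    intro x
    split_ifs with hx
    · rw [hx, zero_pow (Nat.sub_ne_zero_of_lt hp.one_lt), sub_self]
    · simp [ZMod.pow_card_sub_one_eq_one hx]
  simp [h]

/-- Obstruction to `g` enumerating `ℤ/(pc)ℤ`, where `p = 2h + 1` is prime. The set `L` contains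
every exponent `m < h` for which the `2m`-th power sum of `g` modulo `p` may fail to vanish. -/
theorem not_surjective_sphereValue {n p h c : ℕ} (hp : p.Prime) (hph : p = 2 * h + 1)
    (hk : p * c = 2 * n ^ 2 + 2 * n + 1) (L : Finset ℕ)
    (hL : ∀ a ∈ L, ∀ b ∈ L, a + b ≤ h → a + b ∈ L) (hhL : h ∉ L)
    (hcoeff : ∀ m ∈ Finset.Ico 1 h, m ∉ L → (4 * n + 2 + 4 ^ m) % p ≠ 0)
    (hcount : ∀ N ∈ Finset.range (n + 1), ((4 * n + 2 + 4 ^ h) * N + c) % p ≠ 0)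
    (g : Fin n → ZMod (p * c)) : ¬ Function.Surjective (sphereValue g) := by
  intro hsurj
  have : Fact p.Prime := ⟨hp⟩
  have : NeZero (p * c) := ⟨by omega⟩
  have hh : 0 < h := by have := hp.two_le; omega
  have hbij : Function.Bijective (sphereValue g) :=
    (Fintype.bijective_iff_surjective_and_card _).2
      ⟨hsurj, by rw [card_sphereValue_index, ZMod.card, hk]⟩
  set q := ZMod.castHom (Dvd.intro c rfl : p ∣ p * c) (ZMod p)
  set u : Fin n → ZMod p := fun i => q (g i)
  have htotal : ∀ m, ∑ t, sphereValue u t ^ (2 * m) = c * ∑ y : ZMod p, y ^ (2 * m) := by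
    intro m
    rw [← sum_castHom (fun y : ZMod p => y ^ (2 * m)), ← hbij.sum_comp]
    exact Finset.sum_congr rfl fun t _ =>
      congrArg (· ^ (2 * m)) (map_sphereValue q.toAddMonoidHom g t).symm
  have hprod : ∀ m, m ≤ h → m ∉ L →
      (∀ s, 0 < s → s < m → s ∉ L → ∑ i, u i ^ (2 * s) = 0) →
      ∀ s, 0 < s → s < m → (∑ i, u i ^ (2 * s)) * ∑ i, u i ^ (2 * (m - s)) = 0 := by
    intro m hmh hmL hlow s hs hsm
    by_cases hsL : s ∈ L
    · have hmsL : m - s ∉ L := fun hms => hmL <| by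
        have := hL s hsL (m - s) hms (by omega)
        rwa [Nat.add_sub_cancel' hsm.le] at this
      rw [hlow (m - s) (by omega) (by omega) hmsL, mul_zero]
    · rw [hlow s hs hsm hsL, zero_mul]
  have hvanish : ∀ m, 0 < m → m < h → m ∉ L → ∑ i, u i ^ (2 * m) = 0 := by
    intro m
    induction m using Nat.strong_induction_on with
    | _ m ih =>
      intro hm hmh hmL
      have hsum := sum_sphereValue_pow u hm
        (hprod m hmh.le hmL fun s hs hsm hsL => ih s hsm hs (hsm.trans hmh) hsL)
      rw [htotal, FiniteField.sum_pow_lt_card_sub_one (ZMod p) _ (by rw [ZMod.card]; omega),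
        mul_zero] at hsum
      refine (mul_eq_zero.mp hsum.symm).resolve_left fun hzero => ?_
      refine hcoeff m (Finset.mem_Ico.mpr ⟨hm, hmh⟩) hmL (Nat.mod_eq_zero_of_dvd ?_)
      rw [← ZMod.natCast_eq_zero_iff]
      exact_mod_cast hzero
  have hsum := sum_sphereValue_pow u hh
    (hprod h le_rfl hhL fun s hs hsh hsL => hvanish s hs hsh hsL)
  have hph' : 2 * h = p - 1 := by omega
  have hpow : ∑ i, u i ^ (2 * h) = (#{i | u i ≠ 0} : ZMod p) := by
    rw [← Finset.sum_boole]
    refine Finset.sum_congr rfl fun i _ => ?_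
    split_ifs with hi
    · rw [hph', ZMod.pow_card_sub_one_eq_one hi]
    · rw [not_not.mp hi, zero_pow (by omega)]
  rw [htotal, hpow, hph', sum_pow_sub_one_eq_neg_one] at hsum
  refine hcount #{i | u i ≠ 0} (Finset.mem_range.mpr (Nat.lt_succ_of_le ?_))
    (Nat.mod_eq_zero_of_dvd ?_)
  · simpa using Finset.card_le_univ (Finset.univ.filter fun i => u i ≠ 0)
  · rw [← ZMod.natCast_eq_zero_iff]
    push_cast
    rw [← hsum]
    ring

theorem not_surjective_sphereValue_of_mem_Icc {n : ℕ} (h₇ : 7 ≤ n) (h₁₂ : n ≤ 12)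
    (g : Fin n → ZMod (2 * n ^ 2 + 2 * n + 1)) : ¬ Function.Surjective (sphereValue g) := by
  interval_cases n
  · exact not_surjective_sphereValue (p := 113) (h := 56) (c := 1) (by norm_num) rfl rfl
      {11, 22, 25, 33, 36, 39, 44, 47, 50, 53, 55} (by decide) (by decide) (by decide)
      (by decide) g
  · exact not_surjective_sphereValue (p := 5) (h := 2) (c := 29) (by norm_num) rfl rfl
      ∅ (by decide) (by decide) (by decide) (by decide) g
  · exact not_surjective_sphereValue (p := 181) (h := 90) (c := 1) (by norm_num) rfl rfl
      {23, 46, 69} (by decide) (by decide) (by decide +kernel) (by decide) g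
  · exact not_surjective_sphereValue (p := 13) (h := 6) (c := 17) (by norm_num) rfl rfl
      {5} (by decide) (by decide) (by decide) (by decide) g
  · exact not_surjective_sphereValue (p := 53) (h := 26) (c := 5) (by norm_num) rfl rfl
      {7, 14, 21} (by decide) (by decide) (by decide) (by decide) g
  · exact not_surjective_sphereValue (p := 313) (h := 156) (c := 1) (by norm_num) rfl rfl
      {59, 118, 137} (by decide) (by decide) (by decide +kernel) (by decide) g

/-- A nonzero word of Lee weight at most `r + 1` is a signed basis vector plus a word of weight
at most `r`. -/
theorem exists_sub_single_mem_leeSphere {n r : ℕ} {x : Fin n → ℤ} (hx : x ∈ leeSphere n (r + 1))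
    (hx0 : x ≠ 0) : ∃ i, x - Pi.single i 1 ∈ leeSphere n r ∨ x + Pi.single i 1 ∈ leeSphere n r := by
  obtain ⟨i, hi⟩ := Function.ne_iff.mp hx0
  simp only [leeSphere, leeDist, mem_ofPred_eq, Pi.zero_apply, sub_zero] at hx hi ⊢
  have hsplit : ∀ y : Fin n → ℤ, ∑ j, (y j).natAbs =
      (y i).natAbs + ∑ j ∈ Finset.univ.erase i, (y j).natAbs := fun y =>
    (Finset.add_sum_erase _ _ (Finset.mem_univ i)).symm
  have hrest : ∀ y : Fin n → ℤ, (∀ j, j ≠ i → y j = x j) →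
      ∑ j ∈ Finset.univ.erase i, (y j).natAbs = ∑ j ∈ Finset.univ.erase i, (x j).natAbs :=
    fun y hy => Finset.sum_congr rfl fun j hj => by rw [hy j (Finset.ne_of_mem_erase hj)]
  rw [hsplit] at hx
  refine ⟨i, ?_⟩
  rcases hi.lt_or_gt with hneg | hpos
  · right
    rw [hsplit, hrest _ fun j hj => by simp [hj]]
    simp only [Pi.add_apply, Pi.single_eq_same]
    omega
  · left
    rw [hsplit, hrest _ fun j hj => by simp [hj]]
    simp only [Pi.sub_apply, Pi.single_eq_same]
    omega

theorem eq_zero_of_mem_leeSphere_zero {n : ℕ} {x : Fin n → ℤ} (hx : x ∈ leeSphere n 0) :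
    x = 0 := by
  funext i
  have h : ∑ i, (x i).natAbs = 0 := by
    simpa [leeSphere, leeDist] using hx
  simpa using Finset.sum_eq_zero_iff.mp h i (Finset.mem_univ i)

theorem image_leeSphere_two_subset {n : ℕ} {A : Type*} [AddCommGroup A] (hn : 0 < n)
    (φ : (Fin n → ℤ) →+ A) :
    φ '' leeSphere n 2 ⊆ sphereValues fun i => φ (Pi.single i 1) := by
  set g : Fin n → A := fun i => φ (Pi.single i 1) with hg
  have hzero : (0 : A) ∈ sphereValues g :=
    Or.inr ⟨⟨0, hn⟩, ⟨0, hn⟩, le_rfl, Or.inr (Or.inl (sub_self _).symm)⟩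
  have hone : ∀ y ∈ leeSphere n 1, y = 0 ∨ ∃ j, φ y = g j ∨ φ y = -g j := by
    intro y hy
    by_cases hy0 : y = 0
    · exact Or.inl hy0
    · obtain ⟨j, h | h⟩ := exists_sub_single_mem_leeSphere hy hy0
      · refine Or.inr ⟨j, Or.inl ?_⟩
        rw [sub_eq_zero.mp (eq_zero_of_mem_leeSphere_zero h)]
      · refine Or.inr ⟨j, Or.inr ?_⟩
        rw [eq_neg_of_add_eq_zero_left (eq_zero_of_mem_leeSphere_zero h), map_neg]
  rintro _ ⟨x, hx, rfl⟩
  by_cases hx0 : x = 0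
  · rwa [hx0, map_zero]
  obtain ⟨i, h⟩ := exists_sub_single_mem_leeSphere hx hx0
  obtain ⟨y, hy, hxy⟩ : ∃ y ∈ leeSphere n 1, φ x = g i + φ y ∨ φ x = -g i + φ y := by
    rcases h with h | h
    · exact ⟨_, h, Or.inl (by simp [hg])⟩
    · exact ⟨_, h, Or.inr (by simp [hg])⟩
  rcases hone y hy with rfl | ⟨j, hj⟩
  · exact Or.inl ⟨i, by simpa using hxy⟩
  · refine Or.inr ?_
    rcases le_total i j with hij | hij
    · refine ⟨i, j, hij, ?_⟩
      rcases hxy with hxy | hxy <;> rcases hj with hj | hj <;> simp [hxy, hj, sub_eq_add_neg]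
    · refine ⟨j, i, hij, ?_⟩
      rcases hxy with hxy | hxy <;> rcases hj with hj | hj <;>
        simp [hxy, hj, sub_eq_add_neg, add_comm]

theorem sums_not_distinct (n : ℕ) (h₇ : 7 ≤ n) (h₁₂ : n ≤ 12)
    (k : ℕ) (hk : k = 2 * n ^ 2 + 2 * n + 1) :
    (∀ g : Fin n → ZMod k,
      ({x : ZMod k | ∃ i : Fin n, x = g i ∨ x = -g i} ∪
        {x : ZMod k | ∃ i j : Fin n, i ≤ j ∧
          (x = g i + g j ∨ x = g i - g j ∨ x = -g i + g j ∨ x = -g i - g j)}).ncard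
        < 2 * n ^ 2 + 2 * n + 1) ∧
    ¬ ∃ φ : (Fin n → ℤ) →+ ZMod k, Set.BijOn φ (leeSphere n 2) Set.univ := by
  subst hk
  have hne : ∀ g : Fin n → ZMod (2 * n ^ 2 + 2 * n + 1), sphereValues g ≠ univ := fun g hg =>
    not_surjective_sphereValue_of_mem_Icc h₇ h₁₂ g <| range_eq_univ.mp <|
      univ_subset_iff.mp (hg ▸ sphereValues_subset_range g)
  refine ⟨fun g => ?_, ?_⟩
  · change (sphereValues g).ncard < _
    have hlt := ncard_lt_ncard (ssubset_univ_iff.mpr (hne g)) (toFinite _)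
    rwa [ncard_univ, Nat.card_zmod] at hlt
  · rintro ⟨φ, hφ⟩
    refine hne (fun i => φ (Pi.single i 1)) (univ_subset_iff.mp ?_)
    rw [← hφ.image_eq]
    exact image_leeSphere_two_subset (by omega) φ
end

section
/- For every e with 1 ≤ e ≤ 6, there exists a linear QPL(3,e) code, i.e., a subgroup L of ℤ³ such that ρ_L(v,w) ≥ 2e+1 for all distinct v,w ∈ L and every word of ℤ³ is at Lee distance at most e+1 from some element of L. -/
open Set

/-- `L` is a quasi-perfect `e`-error-correcting Lee code `QPL(n,e)`. -/
def IsQPLCode {n : ℕ} (e : ℕ) (L : Set (Fin n → ℤ)) : Prop :=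
  (∀ v ∈ L, ∀ w ∈ L, v ≠ w → 2 * e + 1 ≤ leeDist v w) ∧
  ∀ x : Fin n → ℤ, ∃ c ∈ L, leeDist x c ≤ e + 1

/-- The lattice of all `v ∈ ℤ³` with `v₀ + a v₁ + b v₂ ≡ 0` modulo `m`. -/
def congruenceLattice (m a b : ℤ) : AddSubgroup (Fin 3 → ℤ) where
  carrier := {v | m ∣ v 0 + a * v 1 + b * v 2}
  add_mem' {v w} hv hw := by
    have h := dvd_add hv hw
    rwa [show v 0 + a * v 1 + b * v 2 + (w 0 + a * w 1 + b * w 2) =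
      (v + w) 0 + a * (v + w) 1 + b * (v + w) 2 by simp only [Pi.add_apply]; ring] at h
  zero_mem' := by simp
  neg_mem' {v} hv := by
    have h := dvd_neg.mpr hv
    rwa [show -(v 0 + a * v 1 + b * v 2) = (-v) 0 + a * (-v) 1 + b * (-v) 2 by
      simp only [Pi.neg_apply]; ring] at h

theorem mem_congruenceLattice {m a b : ℤ} {v : Fin 3 → ℤ} :
    v ∈ congruenceLattice m a b ↔ m ∣ v 0 + a * v 1 + b * v 2 :=
  Iff.rfl

/-- The balanced residue of `c` has the least absolute value in the class of `c` modulo `m`. -/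
theorem natAbs_bmod_le_of_dvd_add {m : ℕ} (hm : 0 < m) {x c : ℤ} (h : (m : ℤ) ∣ x + c) :
    (Int.bmod c m).natAbs ≤ x.natAbs := by
  have hlow := Int.le_bmod (x := c) hm
  have hupp := Int.bmod_lt (x := c) hm
  obtain ⟨k, hk⟩ : (m : ℤ) ∣ x + Int.bmod c m := by
    have h' := dvd_sub h (Int.dvd_self_sub_bmod (x := c) (m := m))
    rwa [show x + c - (c - Int.bmod c m) = x + Int.bmod c m by ring] at h'
  rcases lt_trichotomy k 0 with hk0 | rfl | hk0
  · have : (m : ℤ) * k ≤ -m := by nlinarith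
    omega
  · omega
  · have : (m : ℤ) ≤ m * k := by nlinarith
    omega

/-- The integers of absolute value at most `k`. -/
def integerBall (k : ℕ) : List ℤ := (List.range (2 * k + 1)).map fun i : ℕ => (i : ℤ) - k

theorem mem_integerBall {k : ℕ} {x : ℤ} : x ∈ integerBall k ↔ x.natAbs ≤ k := by
  simp only [integerBall, List.mem_map, List.mem_range]
  constructor
  · rintro ⟨i, hi, rfl⟩
    omega
  · intro hx
    exact ⟨(x + k).toNat, by omega, by omega⟩

/-- The residues modulo `m` of `x + a y + b z` over the Lee sphere of radius `r`. -/
def sphereResidues (r m : ℕ) (a b : ℤ) : List ℕ :=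
  (integerBall r).flatMap fun y => (integerBall (r - y.natAbs)).flatMap fun z =>
    (integerBall (r - y.natAbs - z.natAbs)).map fun x => ((x + a * y + b * z) % m).toNat

/-- The natural number whose binary digits are the indicator function of `l`. -/
def bitmask (l : List ℕ) : ℕ := l.foldr (fun v s => 2 ^ v ||| s) 0

theorem mem_of_testBit_bitmask {l : List ℕ} {i : ℕ} (h : (bitmask l).testBit i) : i ∈ l := by
  induction l with
  | nil => simp [bitmask] at h
  | cons v l ih =>
    rw [bitmask, List.foldr_cons, Nat.testBit_or, Bool.or_eq_true, Nat.testBit_two_pow,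
      decide_eq_true_eq] at h
    rcases h with rfl | h
    · exact List.mem_cons_self
    · exact List.mem_cons_of_mem v (ih h)

theorem exists_of_bitmask_sphereResidues {r m : ℕ} {a b : ℤ} (hm : 0 < m)
    (h : bitmask (sphereResidues r m a b) = 2 ^ m - 1) (s : ℤ) :
    ∃ x y z : ℤ, x.natAbs + y.natAbs + z.natAbs ≤ r ∧ (m : ℤ) ∣ s - (x + a * y + b * z) := by
  have hm' : (0 : ℤ) < m := by exact_mod_cast hm
  have hs₀ := Int.emod_nonneg s hm'.ne'
  have hs₁ := Int.emod_lt_of_pos s hm'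
  have hmem : (s % m).toNat ∈ sphereResidues r m a b := by
    refine mem_of_testBit_bitmask ?_
    rw [h, Nat.testBit_two_pow_sub_one, decide_eq_true_eq]
    omega
  simp only [sphereResidues, List.mem_flatMap, List.mem_map, mem_integerBall] at hmem
  obtain ⟨y, hy, z, hz, x, hx, hxyz⟩ := hmem
  have := Int.emod_nonneg (x + a * y + b * z) hm'.ne'
  exact ⟨x, y, z, by omega, Int.ModEq.dvd (show _ % _ = _ % _ by omega)⟩

/-- If no word of Lee weight at most `2e` other than the origin lies in the lattice, and every
residue modulo `m` is attained on the Lee sphere of radius `e + 1`, then the lattice is a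
`QPL(3,e)` code. -/
theorem isQPLCode_congruenceLattice {e m : ℕ} {a b : ℤ} (hm : 2 * e < m)
    (hpack : ∀ y ∈ integerBall (2 * e), ∀ z ∈ integerBall (2 * e),
      (Int.bmod (a * y + b * z) m).natAbs + y.natAbs + z.natAbs ≤ 2 * e → y = 0 ∧ z = 0)
    (hcover : bitmask (sphereResidues (e + 1) m a b) = 2 ^ m - 1) :
    IsQPLCode e (congruenceLattice m a b : Set (Fin 3 → ℤ)) := by
  constructor
  · intro v hv w hw hne
    by_contra! hlt
    have hmem := mem_congruenceLattice.mp (sub_mem hv hw)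
    simp only [leeDist, Fin.sum_univ_three] at hlt
    simp only [Pi.sub_apply, add_assoc] at hmem
    have hbmod := natAbs_bmod_le_of_dvd_add (by omega) hmem
    obtain ⟨h1, h2⟩ := hpack (v 1 - w 1) (mem_integerBall.mpr (by omega))
      (v 2 - w 2) (mem_integerBall.mpr (by omega)) (by omega)
    rw [h1, h2, mul_zero, mul_zero, add_zero, add_zero] at hmem
    have h0 : v 0 - w 0 = 0 := Int.eq_zero_of_abs_lt_dvd hmem (by rw [abs_lt]; omega)
    refine hne (funext fun i => ?_)
    fin_cases i
    exacts [sub_eq_zero.mp h0, sub_eq_zero.mp h1, sub_eq_zero.mp h2]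
  · intro u
    obtain ⟨x, y, z, hxyz, hdvd⟩ :=
      exists_of_bitmask_sphereResidues (by omega) hcover (u 0 + a * u 1 + b * u 2)
    refine ⟨![u 0 - x, u 1 - y, u 2 - z], mem_congruenceLattice.mpr ?_, ?_⟩
    · rw [show u 0 + a * u 1 + b * u 2 - (x + a * y + b * z) =
        (u 0 - x) + a * (u 1 - y) + b * (u 2 - z) by ring] at hdvd
      exact hdvd
    · simpa [leeDist, Fin.sum_univ_three] using hxyz

theorem linear_QPL_dim_three_exists (e : ℕ) (he₁ : 1 ≤ e) (he₂ : e ≤ 6) :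
    ∃ L : AddSubgroup (Fin 3 → ℤ), IsQPLCode e (L : Set (Fin 3 → ℤ)) := by
  interval_cases e
  · exact ⟨congruenceLattice (7 : ℕ) 2 3, isQPLCode_congruenceLattice (by norm_num)
      (by decide +kernel) (by decide +kernel)⟩
  · exact ⟨congruenceLattice (27 : ℕ) 4 10, isQPLCode_congruenceLattice (by norm_num)
      (by decide +kernel) (by decide +kernel)⟩
  · exact ⟨congruenceLattice (70 : ℕ) 16 25, isQPLCode_congruenceLattice (by norm_num)
      (by decide +kernel) (by decide +kernel)⟩
  · exact ⟨congruenceLattice (145 : ℕ) 9 61, isQPLCode_congruenceLattice (by norm_num)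
      (by decide +kernel) (by decide +kernel)⟩
  · exact ⟨congruenceLattice (260 : ℕ) 40 94, isQPLCode_congruenceLattice (by norm_num)
      (by decide +kernel) (by decide +kernel)⟩
  · exact ⟨congruenceLattice (421 : ℕ) 16 182, isQPLCode_congruenceLattice (by norm_num)
      (by decide +kernel) (by decide +kernel)⟩
end

section
/- For every e ≥ 55, there is no linear QPL(3,e) code. -/
open Set

/-- `C` contains the origin, has minimum Lee distance at least `2e + 1` and covering radius at most
`e + 1`; the code is given by a predicate on the three coordinates of a word. -/
structure IsQPLPred (e : ℕ) (C : ℤ → ℤ → ℤ → Prop) : Prop where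
  zero : C 0 0 0
  packing : ∀ a b c a' b' c', C a b c → C a' b' c' → a ≠ a' ∨ b ≠ b' ∨ c ≠ c' →
    2 * e + 1 ≤ (a - a').natAbs + (b - b').natAbs + (c - c').natAbs
  covering : ∀ x y z, ∃ a b c, C a b c ∧
    (x - a).natAbs + (y - b).natAbs + (z - c).natAbs ≤ e + 1

namespace IsQPLPred

variable {e : ℕ} {C : ℤ → ℤ → ℤ → Prop}

theorem swap_left (h : IsQPLPred e C) : IsQPLPred e fun x y z => C y x z where
  zero := h.zero
  packing a b c a' b' c' ha ha' hne := by
    have := h.packing b a c b' a' c' ha ha' (by tauto)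
    omega
  covering x y z := by
    obtain ⟨a, b, c, hC, hd⟩ := h.covering y x z
    exact ⟨b, a, c, hC, by omega⟩

theorem swap_outer (h : IsQPLPred e C) : IsQPLPred e fun x y z => C z y x where
  zero := h.zero
  packing a b c a' b' c' ha ha' hne := by
    have := h.packing c b a c' b' a' ha ha' (by tauto)
    omega
  covering x y z := by
    obtain ⟨a, b, c, hC, hd⟩ := h.covering z y x
    exact ⟨c, b, a, hC, by omega⟩

/-- A word of weight `e + 2` with entries at least `2` is dominated, up to an error of `1` in each
coordinate, by a codeword of weight between `2e + 1` and `2e + 3`. -/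
theorem exists_dominating (h : IsQPLPred e C) {x y z : ℤ} (hx : 2 ≤ x) (hy : 2 ≤ y) (hz : 2 ≤ z)
    (hsum : x + y + z = e + 2) :
    ∃ a b c, C a b c ∧ x - 1 ≤ a ∧ y - 1 ≤ b ∧ z - 1 ≤ c ∧
      2 * e + 1 ≤ a + b + c ∧ a + b + c ≤ 2 * e + 3 := by
  obtain ⟨a, b, c, hC, hd⟩ := h.covering x y z
  have hw := h.packing a b c 0 0 0 hC h.zero (by omega)
  have ha : x - 1 ≤ a := by omega
  have hb : y - 1 ≤ b := by omega
  have hc : z - 1 ≤ c := by omega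
  exact ⟨a, b, c, hC, ha, hb, hc, by omega, by omega⟩

/-- A codeword dominating a word that lies just beyond the edge `x = a` of the triangle of words of
weight `e + 2` dominated by `(a, b, c)` almost agrees with that word in the last two coordinates. -/
theorem exists_dominating_near (h : IsQPLPred e C) {a b c y z : ℤ} (hC : C a b c)
    (hle : a + b + c ≤ 2 * e + 3) (hge : 2 * e + 1 ≤ a + b + c) (ha : 0 ≤ a)
    (hy : 2 ≤ y) (hz : 2 ≤ z) (hyb : y + 5 ≤ b) (hzc : z + 5 ≤ c) (hsum : a + y + z = e) :
    ∃ a' b' c', C a' b' c' ∧ y - 1 ≤ b' ∧ b' ≤ y + 4 ∧ z - 1 ≤ c' ∧ c' ≤ z + 4 ∧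
      2 * e + 1 ≤ a' + b' + c' ∧ a' + b' + c' ≤ 2 * e + 3 := by
  obtain ⟨a', b', c', hC', h1, h2, h3, h4, h5⟩ :=
    h.exists_dominating (x := a + 2) (by omega) hy hz (by omega)
  have hd := h.packing a b c a' b' c' hC hC' (by omega)
  exact ⟨a', b', c', hC', h2, by omega, h3, by omega, h4, h5⟩

theorem false_of_mem (h : IsQPLPred e C) (he : 55 ≤ e) {a b c : ℤ} (hC : C a b c)
    (hle : a + b + c ≤ 2 * e + 3) (hge : 2 * e + 1 ≤ a + b + c) (ha : 0 ≤ a)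
    (hae : a + 10 ≤ e) (hb : 13 ≤ b) (hc : 13 ≤ c) : False := by
  obtain ⟨y, hy, hz, hyb, hzc⟩ :
      ∃ y : ℤ, 2 ≤ y ∧ 2 ≤ e - a - (y + 6) ∧ y + 6 + 5 ≤ b ∧ e - a - y + 5 ≤ c :=
    ⟨max 2 (e - a - c + 5), by omega, by omega, by omega, by omega⟩
  obtain ⟨a₁, b₁, c₁, hC₁, _, _, _, _, _, _⟩ :=
    h.exists_dominating_near (y := y) (z := e - a - y) hC hle hge ha hy (by omega) (by omega) hzc
      (by omega)
  obtain ⟨a₂, b₂, c₂, hC₂, _, _, _, _, _, _⟩ :=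
    h.exists_dominating_near (y := y + 6) (z := e - a - (y + 6)) hC hle hge ha (by omega) hz hyb
      (by omega) (by omega)
  have hd := h.packing a₁ b₁ c₁ a₂ b₂ c₂ hC₁ hC₂ (by omega)
  omega

theorem not_of_le (he : 55 ≤ e) : ¬ IsQPLPred e C := by
  intro h
  obtain ⟨a, b, c, hC, ha, hb, hc, hge, hle⟩ :=
    h.exists_dominating (x := (e + 2) / 3) (y := (e + 2) / 3) (z := e + 2 - 2 * ((e + 2) / 3))
      (by omega) (by omega) (by omega) (by omega)
  have hmin : a + 10 ≤ e ∨ b + 10 ≤ e ∨ c + 10 ≤ e := by omega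
  rcases hmin with hm | hm | hm
  · exact h.false_of_mem he hC hle hge (by omega) hm (by omega) (by omega)
  · exact h.swap_left.false_of_mem he (a := b) (b := a) (c := c) hC (by omega) (by omega)
      (by omega) hm (by omega) (by omega)
  · exact h.swap_outer.false_of_mem he (a := c) (b := b) (c := a) hC (by omega) (by omega)
      (by omega) hm (by omega) (by omega)

end IsQPLPred

theorem no_linear_QPL_dim_three_large_e (e : ℕ) (he : 55 ≤ e) :
    ¬ ∃ L : AddSubgroup (Fin 3 → ℤ), IsQPLCode e (L : Set (Fin 3 → ℤ)) := by
  rintro ⟨L, hpack, hcov⟩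
  refine IsQPLPred.not_of_le (C := fun x y z => ![x, y, z] ∈ L) he ⟨?_, ?_, ?_⟩
  · convert L.zero_mem
    ext i
    fin_cases i <;> rfl
  · intro a b c a' b' c' h h' hne
    have hd := hpack _ h _ h' fun heq => by
      have h0 := congrFun heq 0
      have h1 := congrFun heq 1
      have h2 := congrFun heq 2
      simp at h0 h1 h2
      tauto
    simpa [leeDist, Fin.sum_univ_three] using hd
  · intro x y z
    obtain ⟨c, hc, hd⟩ := hcov ![x, y, z]
    refine ⟨c 0, c 1, c 2, ?_, by simpa [leeDist, Fin.sum_univ_three] using hd⟩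
    convert SetLike.mem_coe.mp hc
    ext i
    fin_cases i <;> rfl
end
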